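/- arXiv:math/9712213 — 2 statements merged into one kernel-verified Lean document; each statement's English description precedes it below -/
import Mathlib

section
/- Let a ≥ 1 be an integer. For every n ≥ 1, the number of regions of the extended Shi arrangement in V_{n-1}, given by the hyperplanes x_i − x_j = k for every integer k with −a+1 ≤ k ≤ a and all 1 ≤ i < j ≤ n, equals (a·n + 1)^{n−1}. -/
/-- The number of regions of the complement of an arrangement. -/
noncomputable def numRegions {V : Type*} [TopologicalSpace V] (s : Set V) : ℕ :=
  Nat.card (ConnectedComponents s)

open Polynomial

section Gain

variable {V : Type} {K : Type*}

/-- The affine form `x_i - x_j - k` attached to a triple `(i, j, k)`. -/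
def gainForm [Ring K] (e : V × V × ℤ) (x : V → K) : K := x e.1 - x e.2.1 - (e.2.2 : K)

open Classical in
/-- The number of cells cut out of `C` by the hyperplanes `gainForm e = 0`, `e ∈ L`, defined by
cutting successively along the hyperplanes of the list. -/
noncomputable def cellCount : List (V × V × ℤ) → Set (V → ℝ) → ℕ
  | [], C => if C.Nonempty then 1 else 0
  | e :: L, C => cellCount L (C ∩ {x | 0 < gainForm e x}) + cellCount L (C ∩ {x | gainForm e x < 0})

theorem continuous_gainForm (e : V × V × ℤ) : Continuous (gainForm (K := ℝ) e) := by
  unfold gainForm; fun_prop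

theorem convex_gainForm_pos (e : V × V × ℤ) : Convex ℝ {x : V → ℝ | 0 < gainForm e x} := by
  intro x hx y hy s t hs ht hst
  simp only [Set.mem_ofPred_eq, gainForm, Pi.add_apply, Pi.smul_apply, smul_eq_mul] at *
  rcases hs.eq_or_lt with rfl | hs
  · obtain rfl : t = 1 := by linarith
    linarith
  · obtain rfl : t = 1 - s := by linarith
    nlinarith [mul_pos hs hx, mul_nonneg ht hy.le]

theorem convex_gainForm_neg (e : V × V × ℤ) : Convex ℝ {x : V → ℝ | gainForm e x < 0} := by
  convert convex_gainForm_pos (e.2.1, e.1, -e.2.2) using 3 with x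
  simp only [gainForm, Int.cast_neg]
  constructor <;> intro h <;> linarith

theorem cellCount_empty (L : List (V × V × ℤ)) : cellCount L ∅ = 0 := by
  induction L with
  | nil => simp [cellCount]
  | cons e L ih => simp [cellCount, ih]

/-- Deletion and restriction for cells of an open convex set. -/
theorem cellCount_cons_of_ne [Fintype V] (L : List (V × V × ℤ)) {e : V × V × ℤ} (he : e.1 ≠ e.2.1)
    {C : Set (V → ℝ)} (hC : Convex ℝ C) (hCo : IsOpen C) :
    cellCount (e :: L) C = cellCount L C + cellCount L (C ∩ {x | gainForm e x = 0}) := by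
  classical
  rw [cellCount]
  induction L generalizing C with
  | nil =>
    simp only [cellCount]
    by_cases h0 : (C ∩ {x | gainForm e x = 0}).Nonempty
    · obtain ⟨x, hxC, hx⟩ := h0
      have hcont : Continuous fun t : ℝ => x + t • (Pi.single e.1 1 : V → ℝ) := by fun_prop
      have hval : ∀ t : ℝ, gainForm e (x + t • (Pi.single e.1 1 : V → ℝ)) = t := by
        intro t
        have : gainForm e x = 0 := hx
        simp only [gainForm, Pi.add_apply, Pi.smul_apply, Pi.single_eq_same, smul_eq_mul,
          Pi.single_eq_of_ne he.symm] at *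
        linarith
      obtain ⟨ε, hε, hb⟩ := Metric.mem_nhds_iff.1
        ((hCo.preimage hcont).mem_nhds (show (0 : ℝ) ∈ _ by simpa using hxC))
      have h1 : (C ∩ {x | 0 < gainForm e x}).Nonempty :=
        ⟨_, hb (show ε / 2 ∈ _ by simp [abs_of_pos hε, hε]), by
          simp only [Set.mem_ofPred_eq, hval]; positivity⟩
      have h2 : (C ∩ {x | gainForm e x < 0}).Nonempty :=
        ⟨_, hb (show -(ε / 2) ∈ _ by simp [abs_of_pos hε, hε]), by
          simp only [Set.mem_ofPred_eq, hval]; linarith⟩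
      rw [if_pos h1, if_pos h2, if_pos ⟨x, hxC⟩, if_pos ⟨x, hxC, hx⟩]
    · rw [if_neg h0]
      by_cases h1 : (C ∩ {x | 0 < gainForm e x}).Nonempty <;>
        by_cases h2 : (C ∩ {x | gainForm e x < 0}).Nonempty
      · obtain ⟨x, hxC, hx⟩ := h1
        obtain ⟨y, hyC, hy⟩ := h2
        obtain ⟨z, hz, hz0⟩ := hC.isPreconnected.intermediate_value hyC hxC
          (continuous_gainForm e).continuousOn ⟨hy.le, hx.le⟩
        exact absurd ⟨z, hz, hz0⟩ h0
      · rw [if_pos h1, if_neg h2, if_pos (h1.mono Set.inter_subset_left)]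
      · rw [if_neg h1, if_pos h2, if_pos (h2.mono Set.inter_subset_left)]
      · rw [if_neg h1, if_neg h2, if_neg]
        rintro ⟨x, hx⟩
        rcases lt_trichotomy (gainForm e x) 0 with h | h | h
        exacts [h2 ⟨x, hx, h⟩, h0 ⟨x, hx, h⟩, h1 ⟨x, hx, h⟩]
  | cons d L ih =>
    have hp := ih (hC.inter (convex_gainForm_pos d))
      (hCo.inter (isOpen_lt continuous_const (continuous_gainForm d)))
    have hn := ih (hC.inter (convex_gainForm_neg d))
      (hCo.inter (isOpen_lt (continuous_gainForm d) continuous_const))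
    simp only [cellCount]
    simp only [Set.inter_right_comm C _ {x | 0 < gainForm d x},
      Set.inter_right_comm C _ {x | gainForm d x < 0}]
    omega

/-- The number of points over `ZMod q` off all the hyperplanes of the list. -/
noncomputable def pointCount (q : ℕ) (L : List (V × V × ℤ)) : ℕ :=
  Nat.card {x : V → ZMod q // ∀ e ∈ L, gainForm e x ≠ 0}

variable [DecidableEq V]

/-- The vertex replacing `v` when `i` is merged into `j`. -/
def mergeVertex {i j : V} (h : i ≠ j) (v : V) : {v : V // v ≠ i} :=
  if hv : v = i then ⟨j, h.symm⟩ else ⟨v, hv⟩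

/-- The shift picked up by `v` when `x_i` is replaced by `x_j + k`. -/
def mergeShift (i : V) (k : ℤ) (v : V) : ℤ := if v = i then k else 0

/-- The substitution `x_i = x_j + k` on triples. -/
def mergeEdge {i j : V} (h : i ≠ j) (k : ℤ) (e : V × V × ℤ) :
    {v : V // v ≠ i} × {v : V // v ≠ i} × ℤ :=
  (mergeVertex h e.1, mergeVertex h e.2.1,
    e.2.2 - mergeShift i k e.1 + mergeShift i k e.2.1)

/-- The parametrization of the hyperplane `x_i = x_j + k` by the other coordinates. -/
def mergePoint [Ring K] {i j : V} (h : i ≠ j) (k : ℤ) (y : {v : V // v ≠ i} → K) (v : V) : K :=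
  y (mergeVertex h v) + mergeShift i k v

theorem gainForm_mergePoint [Ring K] {i j : V} (h : i ≠ j) (k : ℤ) (e : V × V × ℤ)
    (y : {v : V // v ≠ i} → K) :
    gainForm e (mergePoint h k y) = gainForm (mergeEdge h k e) y := by
  simp only [gainForm, mergePoint, mergeEdge, Int.cast_add, Int.cast_sub]
  abel

theorem mergePoint_injective [Ring K] {i j : V} (h : i ≠ j) (k : ℤ) :
    Function.Injective (mergePoint (K := K) h k) := by
  intro y z hyz
  ext ⟨v, hv⟩
  simpa [mergePoint, mergeVertex, mergeShift, hv] using congrFun hyz v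

theorem range_mergePoint [Ring K] {i j : V} (h : i ≠ j) (k : ℤ) :
    Set.range (mergePoint (K := K) h k) = {x | gainForm (i, j, k) x = 0} := by
  ext x
  constructor
  · rintro ⟨y, rfl⟩
    simp [gainForm, mergePoint, mergeVertex, mergeShift, h.symm]
  · intro hx
    refine ⟨fun v => x v, ?_⟩
    ext v
    by_cases hv : v = i
    · subst hv
      simp only [Set.mem_ofPred_eq, gainForm] at hx
      simp only [mergePoint, mergeVertex, mergeShift, if_true, dite_true]
      rw [sub_sub, sub_eq_zero] at hx
      exact hx.symm
    · simp [mergePoint, mergeVertex, mergeShift, hv]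

theorem cellCount_preimage_mergePoint {i j : V} (h : i ≠ j) (k : ℤ) (L : List (V × V × ℤ))
    {C : Set (V → ℝ)} (hC : C ⊆ Set.range (mergePoint h k)) :
    cellCount L C = cellCount (L.map (mergeEdge h k)) (mergePoint h k ⁻¹' C) := by
  induction L generalizing C with
  | nil =>
    have : (mergePoint h k ⁻¹' C).Nonempty ↔ C.Nonempty :=
      ⟨fun ⟨y, hy⟩ => ⟨_, hy⟩, fun ⟨x, hx⟩ => by
        obtain ⟨y, rfl⟩ := hC hx
        exact ⟨y, hx⟩⟩
    simp only [cellCount, List.map_nil]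
    split_ifs <;> tauto
  | cons e L ih =>
    rw [List.map_cons, cellCount, cellCount, ih (Set.inter_subset_left.trans hC),
      ih (Set.inter_subset_left.trans hC)]
    simp [Set.preimage_inter, gainForm_mergePoint]

theorem pointCount_cons_add (q : ℕ) [NeZero q] [Finite V] {i j : V} (h : i ≠ j) (k : ℤ)
    (L : List (V × V × ℤ)) :
    pointCount q ((i, j, k) :: L) + pointCount q (L.map (mergeEdge h k)) = pointCount q L := by
  classical
  unfold pointCount
  have e1 : {y : {v : V // v ≠ i} → ZMod q // ∀ e ∈ L.map (mergeEdge h k), gainForm e y ≠ 0} ≃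
      {x : {x : V → ZMod q // ∀ e ∈ L, gainForm e x ≠ 0} // ¬ gainForm (i, j, k) x.1 ≠ 0} := by
    refine Equiv.ofBijective (fun y => ⟨⟨mergePoint h k y.1, fun e he => ?_⟩, ?_⟩) ⟨?_, ?_⟩
    · rw [gainForm_mergePoint]
      exact y.2 _ (List.mem_map_of_mem he)
    · rw [not_not]
      have : mergePoint h k y.1 ∈ Set.range (mergePoint (K := ZMod q) h k) := ⟨_, rfl⟩
      rwa [range_mergePoint] at this
    · intro y z hyz
      simp only [Subtype.mk.injEq] at hyz
      exact Subtype.ext (mergePoint_injective h k hyz)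
    · rintro ⟨⟨x, hx⟩, hx0⟩
      rw [not_not] at hx0
      have : x ∈ Set.range (mergePoint (K := ZMod q) h k) := by rwa [range_mergePoint]
      obtain ⟨y, rfl⟩ := this
      refine ⟨⟨y, ?_⟩, rfl⟩
      simp only [List.mem_map, forall_exists_index, and_imp, forall_apply_eq_imp_iff₂]
      intro e he
      rw [← gainForm_mergePoint]
      exact hx e he
  have e2 : {x : V → ZMod q // ∀ e ∈ (i, j, k) :: L, gainForm e x ≠ 0} ≃
      {x : {x : V → ZMod q // ∀ e ∈ L, gainForm e x ≠ 0} // gainForm (i, j, k) x.1 ≠ 0} :=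
    (Equiv.subtypeEquivRight fun x => by rw [List.forall_mem_cons, and_comm]).trans
      (Equiv.subtypeSubtypeEquivSubtypeInter (fun x : V → ZMod q => ∀ e ∈ L, gainForm e x ≠ 0)
        fun x => gainForm (i, j, k) x ≠ 0).symm
  rw [Nat.card_congr e1, Nat.card_congr e2, ← Nat.card_sum]
  exact Nat.card_congr (Equiv.sumCompl _)

end Gain

/-- Zaslavsky's theorem combined with the finite field method. -/
theorem exists_charPoly {V : Type} [Fintype V] (L : List (V × V × ℤ)) :
    ∃ P : ℤ[X], (∃ q₀ : ℕ, ∀ q ≥ q₀, (pointCount q L : ℤ) = P.eval (q : ℤ)) ∧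
      (cellCount L (Set.univ : Set (V → ℝ)) : ℤ) = (-1) ^ Fintype.card V * P.eval (-1) := by
  classical
  induction hl : L.length generalizing V with
  | zero =>
    obtain rfl := List.length_eq_zero_iff.1 hl
    refine ⟨X ^ Fintype.card V, ⟨1, fun q hq => ?_⟩, ?_⟩
    · have : NeZero q := ⟨by omega⟩
      simp [pointCount, Nat.card_eq_fintype_card]
    · simp [cellCount, ← mul_pow]
  | succ m ih =>
    obtain _ | ⟨⟨i, j, k⟩, L⟩ := L
    · simp at hl
    simp only [List.length_cons, Nat.add_right_cancel_iff] at hl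
    obtain ⟨P, ⟨q₀, hP⟩, hPr⟩ := ih L hl
    by_cases hij : i = j
    · subst hij
      by_cases hk : k = 0
      · subst hk
        refine ⟨0, ⟨0, fun q _ => ?_⟩, ?_⟩
        · simp [pointCount, gainForm]
        · simp [cellCount, gainForm, cellCount_empty]
      · refine ⟨P, ⟨max q₀ (k.natAbs + 1), fun q hq => ?_⟩, ?_⟩
        · rw [← hP q (le_of_max_le_left hq)]
          have hkq : (k : ZMod q) ≠ 0 := by
            rw [Ne, ZMod.intCast_zmod_eq_zero_iff_dvd]
            intro hd
            have := Nat.le_of_dvd (by omega) (Int.natCast_dvd.1 hd)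
            have := le_of_max_le_right hq
            omega
          simp [pointCount, gainForm, hkq]
        · rw [← hPr]
          rcases lt_or_gt_of_ne hk with h | h
          · have h' : (k : ℝ) < 0 := by exact_mod_cast h
            simp [cellCount, gainForm, h', not_lt.2 h.le, cellCount_empty]
          · have h' : (0 : ℝ) < k := by exact_mod_cast h
            simp [cellCount, gainForm, h', not_lt.2 h.le, cellCount_empty]
    · obtain ⟨R, ⟨q₁, hR⟩, hRr⟩ := ih (L.map (mergeEdge hij k)) (by simpa using hl)
      refine ⟨P - R, ⟨max (max q₀ q₁) 1, fun q hq => ?_⟩, ?_⟩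
      · have : NeZero q := ⟨by have := le_of_max_le_right hq; omega⟩
        have := pointCount_cons_add q hij k L
        have hq := le_of_max_le_left hq
        rw [eval_sub, ← hP q (le_of_max_le_left hq), ← hR q (le_of_max_le_right hq), ← this]
        push_cast; ring
      · rw [cellCount_cons_of_ne L (e := (i, j, k)) hij convex_univ isOpen_univ, Set.univ_inter,
          ← range_mergePoint hij k, cellCount_preimage_mergePoint hij k L subset_rfl,
          Set.preimage_range]
        push_cast
        rw [hPr, hRr, eval_sub]
        have : Fintype.card V = Fintype.card {v : V // v ≠ i} + 1 := by
          have := Fintype.card_pos_iff.2 ⟨i⟩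
          rw [Fintype.card_subtype_compl, Fintype.card_subtype_eq]
          omega
        rw [this]
        ring

section Regions

theorem card_connectedComponents_of_split {X : Type*} [TopologicalSpace X] {U : Bool → Set X}
    (hU : ∀ b, IsClopen (U b)) (hd : Pairwise (Function.onFun Disjoint U)) (hc : ⋃ b, U b = Set.univ)
    [∀ b, Finite (ConnectedComponents (U b))] :
    Finite (ConnectedComponents X) ∧ Nat.card (ConnectedComponents X) =
      Nat.card (ConnectedComponents (U true)) + Nat.card (ConnectedComponents (U false)) := by
  have e := ConnectedComponents.equivOfIsClopen hU hd hc
  refine ⟨Finite.of_equiv _ e.symm, ?_⟩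
  rw [Nat.card_congr e, Nat.card_sigma, Fintype.sum_bool]

/-- A homeomorphism induces a bijection on connected components. -/
noncomputable def Homeomorph.connectedComponentsEquiv {X Y : Type*} [TopologicalSpace X]
    [TopologicalSpace Y] (e : X ≃ₜ Y) : ConnectedComponents X ≃ ConnectedComponents Y where
  toFun := e.continuous.connectedComponentsMap
  invFun := e.symm.continuous.connectedComponentsMap
  left_inv x := by
    obtain ⟨x, rfl⟩ := ConnectedComponents.surjective_coe x
    simp [Continuous.connectedComponentsMap, Continuous.connectedComponentsLift_apply_coe]
  right_inv x := by
    obtain ⟨x, rfl⟩ := ConnectedComponents.surjective_coe x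
    simp [Continuous.connectedComponentsMap, Continuous.connectedComponentsLift_apply_coe]

/-- The homeomorphism from a subset of `S` to its image in the ambient space. -/
noncomputable def homeomorphInterOfEq {E : Type*} [TopologicalSpace E] {S T : Set E} {U : Set S}
    (h : Subtype.val '' U = T) : U ≃ₜ T :=
  (Topology.IsEmbedding.subtypeVal.comp Topology.IsEmbedding.subtypeVal).toHomeomorph.trans
    (Homeomorph.setCongr (by rw [Set.range_comp, Subtype.range_coe, h]))

theorem numRegions_split {E : Type*} [TopologicalSpace E] {S : Set E} {f : E → ℝ}
    (hf : Continuous f) (h0 : ∀ x ∈ S, f x ≠ 0)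
    (h1 : Finite (ConnectedComponents ↥(S ∩ {x | 0 < f x})))
    (h2 : Finite (ConnectedComponents ↥(S ∩ {x | f x < 0}))) :
    Finite (ConnectedComponents S) ∧
      numRegions S = numRegions (S ∩ {x | 0 < f x}) + numRegions (S ∩ {x | f x < 0}) := by
  let U : Bool → Set S := fun b => bif b then {x | 0 < f x} else {x | f x < 0}
  have hg : Continuous fun x : S => f x := hf.comp continuous_subtype_val
  have e1 : U true ≃ₜ ↥(S ∩ {x | 0 < f x}) := homeomorphInterOfEq (by ext; simp [U]; tauto)
  have e2 : U false ≃ₜ ↥(S ∩ {x | f x < 0}) := homeomorphInterOfEq (by ext; simp [U]; tauto)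
  have hcompl : U false = (U true)ᶜ := by
    ext x
    have := h0 x x.2
    simp only [U, cond_true, cond_false, Set.mem_compl_iff, Set.mem_ofPred_eq, not_lt]
    exact ⟨le_of_lt, fun h => lt_of_le_of_ne h this⟩
  have ho1 : IsOpen (U true) := isOpen_lt continuous_const hg
  have ho2 : IsOpen (U false) := isOpen_lt hg continuous_const
  have hU : ∀ b, IsClopen (U b) := by
    have ht : IsClopen (U true) := ⟨⟨hcompl ▸ ho2⟩, ho1⟩
    rintro (_ | _)
    · exact hcompl ▸ ht.compl
    · exact ht
  have hfin : ∀ b, Finite (ConnectedComponents (U b)) := by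
    rintro (_ | _)
    · exact Finite.of_equiv _ e2.connectedComponentsEquiv.symm
    · exact Finite.of_equiv _ e1.connectedComponentsEquiv.symm
  have hd : Pairwise (Function.onFun Disjoint U) := by
    rintro (_ | _) (_ | _) h
    · exact absurd rfl h
    · rw [Function.onFun, hcompl]
      exact disjoint_compl_left
    · rw [Function.onFun, hcompl]
      exact disjoint_compl_right
    · exact absurd rfl h
  have hc : ⋃ b, U b = Set.univ := by
    refine Set.eq_univ_of_forall fun x => Set.mem_iUnion.2 ?_
    by_cases hx : x ∈ U true
    · exact ⟨true, hx⟩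
    · exact ⟨false, hcompl ▸ hx⟩
  have := card_connectedComponents_of_split hU hd hc
  rwa [Nat.card_congr e1.connectedComponentsEquiv, Nat.card_congr e2.connectedComponentsEquiv] at this

variable {V : Type}

theorem numRegions_eq_cellCount (L : List (V × V × ℤ)) {C : Set (V → ℝ)} (hC : Convex ℝ C) :
    Finite (ConnectedComponents ↥(C ∩ {x | ∀ e ∈ L, gainForm e x ≠ 0})) ∧
      numRegions (C ∩ {x | ∀ e ∈ L, gainForm e x ≠ 0}) = cellCount L C := by
  induction L generalizing C with
  | nil =>
    have : C ∩ {x | ∀ e ∈ ([] : List (V × V × ℤ)), gainForm e x ≠ 0} = C := by simp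
    rw [this, numRegions, cellCount]
    have : PreconnectedSpace C := Subtype.preconnectedSpace hC.isPreconnected
    refine ⟨inferInstance, ?_⟩
    split_ifs with h
    · have := h.to_subtype
      exact Nat.card_unique
    · rw [Set.not_nonempty_iff_eq_empty] at h
      subst h
      have : IsEmpty (ConnectedComponents ↥(∅ : Set (V → ℝ))) :=
        ConnectedComponents.isEmpty_iff_isEmpty.2 inferInstance
      exact Nat.card_of_isEmpty
  | cons e L ih =>
    have hp := ih (hC.inter (convex_gainForm_pos e))
    have hn := ih (hC.inter (convex_gainForm_neg e))
    rw [cellCount, ← hp.2, ← hn.2]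
    have e1 : C ∩ {x | 0 < gainForm e x} ∩ {x | ∀ e ∈ L, gainForm e x ≠ 0} =
        C ∩ {x | ∀ d ∈ e :: L, gainForm d x ≠ 0} ∩ {x | 0 < gainForm e x} := by
      ext x
      simp only [Set.mem_inter_iff, Set.mem_ofPred_eq, List.forall_mem_cons]
      exact ⟨fun h => ⟨⟨h.1.1, h.1.2.ne', h.2⟩, h.1.2⟩, fun h => ⟨⟨h.1.1, h.2⟩, h.1.2.2⟩⟩
    have e2 : C ∩ {x | gainForm e x < 0} ∩ {x | ∀ e ∈ L, gainForm e x ≠ 0} =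
        C ∩ {x | ∀ d ∈ e :: L, gainForm d x ≠ 0} ∩ {x | gainForm e x < 0} := by
      ext x
      simp only [Set.mem_inter_iff, Set.mem_ofPred_eq, List.forall_mem_cons]
      exact ⟨fun h => ⟨⟨h.1.1, h.1.2.ne, h.2⟩, h.1.2⟩, fun h => ⟨⟨h.1.1, h.2⟩, h.1.2.2⟩⟩
    rw [e1] at hp ⊢
    rw [e2] at hn ⊢
    exact numRegions_split (continuous_gainForm e)
      (fun x hx => (List.forall_mem_cons.1 hx.2).1) hp.1 hn.1

/-- Slicing a translation invariant set by `∑ x_i = 0` does not change the number of cells. -/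
theorem cellCount_inter_sum_eq_zero [Fintype V] [Nonempty V] (L : List (V × V × ℤ))
    {C : Set (V → ℝ)} (hC : ∀ x ∈ C, ∀ t : ℝ, (fun v => x v + t) ∈ C) :
    cellCount L (C ∩ {x | ∑ v, x v = 0}) = cellCount L C := by
  induction L generalizing C with
  | nil =>
    have : (C ∩ {x | ∑ v, x v = 0}).Nonempty ↔ C.Nonempty := by
      refine ⟨fun h => h.mono Set.inter_subset_left, fun ⟨x, hx⟩ =>
        ⟨_, hC x hx (-(∑ v, x v) / Fintype.card V), ?_⟩⟩
      have : (Fintype.card V : ℝ) ≠ 0 := by simp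
      simp only [Set.mem_ofPred_eq, Finset.sum_add_distrib, Finset.sum_const, Finset.card_univ,
        nsmul_eq_mul]
      field_simp
      ring
    simp only [cellCount]
    split_ifs <;> tauto
  | cons e L ih =>
    rw [cellCount, cellCount, Set.inter_right_comm C _ {x | 0 < gainForm e x},
      Set.inter_right_comm C _ {x | gainForm e x < 0}, ih, ih]
    · rintro x ⟨hx, hx'⟩ t
      exact ⟨hC x hx t, by simpa [gainForm] using hx'⟩
    · rintro x ⟨hx, hx'⟩ t
      exact ⟨hC x hx t, by simpa [gainForm] using hx'⟩

end Regions

section Counting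

variable {n : ℕ}

/-- The point `x` lies on no hyperplane `x_i - x_j = k` with `i < j` and `-a + 1 ≤ k ≤ a`. -/
def ShiAvoids {K : Type*} [Ring K] (a : ℕ) (x : Fin n → K) : Prop :=
  ∀ i j : Fin n, i < j → ∀ k : ℤ, -(a : ℤ) + 1 ≤ k → k ≤ a → x i - x j ≠ k

/-- The label `j` precedes `i`: labels are ordered by the value of `f`, then by size. -/
def LabelBefore (f : Fin n → ℤ) (j i : Fin n) : Prop := f j < f i ∨ f j = f i ∧ j < i

theorem LabelBefore.trans {f : Fin n → ℤ} {i j k : Fin n} (h : LabelBefore f i j)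
    (h' : LabelBefore f j k) : LabelBefore f i k := by
  unfold LabelBefore at *
  omega

theorem labelBefore_or {i j : Fin n} (f : Fin n → ℤ) (h : i ≠ j) :
    LabelBefore f i j ∨ LabelBefore f j i := by
  unfold LabelBefore
  omega

theorem LabelBefore.not_symm {f : Fin n → ℤ} {i j : Fin n} (h : LabelBefore f i j) :
    ¬ LabelBefore f j i := by
  unfold LabelBefore at *
  omega

open Classical in
/-- The number of labels preceding `i`. -/
noncomputable def labelRank (f : Fin n → ℤ) (i : Fin n) : ℕ :=
  (Finset.univ.filter fun j => LabelBefore f j i).card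

theorem labelRank_lt {f : Fin n → ℤ} {i j : Fin n} (h : LabelBefore f i j) :
    labelRank f i < labelRank f j := by
  classical
  refine Finset.card_lt_card (Finset.ssubset_iff_subset_ne.2 ⟨fun k hk => ?_, fun he => ?_⟩)
  · simp only [Finset.mem_filter, Finset.mem_univ, true_and] at *
    exact hk.trans h
  · have : i ∈ Finset.univ.filter fun k => LabelBefore f k i := by
      rw [he]; simpa using h
    simp only [Finset.mem_filter, Finset.mem_univ, true_and] at this
    exact this.not_symm this

theorem labelRank_lt_card (f : Fin n → ℤ) (i : Fin n) : labelRank f i < n := by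
  classical
  have : (Finset.univ.filter fun j => LabelBefore f j i) ⊂ Finset.univ := by
    refine Finset.filter_ssubset.2 ⟨i, Finset.mem_univ _, fun h => h.not_symm h⟩
  simpa [labelRank] using Finset.card_lt_card this

/-- Spread out the labels, each of them taking `a` cells. -/
noncomputable def spread (a : ℕ) (f : Fin n → ℤ) (i : Fin n) : ℤ := f i + a * labelRank f i

theorem LabelBefore.spread_add_le {f : Fin n → ℤ} {i j : Fin n} (h : LabelBefore f j i) (a : ℕ) :
    spread a f j + (f i - f j) + a ≤ spread a f i := by
  have : ((labelRank f j : ℤ) + 1) ≤ labelRank f i := by exact_mod_cast labelRank_lt h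
  have := mul_le_mul_of_nonneg_left this (Int.natCast_nonneg a)
  unfold spread
  linarith

theorem LabelBefore.le {f : Fin n → ℤ} {i j : Fin n} (h : LabelBefore f j i) : f j ≤ f i := by
  unfold LabelBefore at h
  omega

theorem spread_lt_spread_iff {a : ℕ} (ha : 1 ≤ a) {f : Fin n → ℤ} {i j : Fin n} :
    spread a f j < spread a f i ↔ LabelBefore f j i := by
  refine ⟨fun h => ?_, fun h => ?_⟩
  · obtain hij | hij := labelBefore_or f (i := j) (j := i) (by rintro rfl; exact lt_irrefl _ h)
    · exact hij
    · have := hij.spread_add_le a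
      have := hij.le
      omega
  · have := h.spread_add_le a
    have := h.le
    omega

theorem shiAvoids_spread {a : ℕ} (f : Fin n → ℤ) : ShiAvoids a (spread a f) := by
  intro i j hij k hk hk' h
  simp only [Int.cast_id] at h
  obtain hb | hb := labelBefore_or f hij.ne
  · have := hb.spread_add_le a
    have := hb.le
    omega
  · have := hb.spread_add_le a
    have := hb.le
    unfold LabelBefore at hb
    omega

/-- The number of entries of `x` below `x i`. -/
def valueRank (x : Fin n → ℤ) (i : Fin n) : ℕ := (Finset.univ.filter fun j => x j < x i).card

theorem labelRank_eq_valueRank_spread {a : ℕ} (ha : 1 ≤ a) (f : Fin n → ℤ) (i : Fin n) :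
    labelRank f i = valueRank (spread a f) i := by
  classical
  unfold labelRank valueRank
  congr 1
  ext j
  simp [spread_lt_spread_iff ha]

theorem spread_injective {a : ℕ} (ha : 1 ≤ a) :
    Function.Injective (spread (n := n) a) := by
  intro f g h
  ext i
  have hi := congrFun h i
  unfold spread at hi
  rw [labelRank_eq_valueRank_spread ha f, labelRank_eq_valueRank_spread ha g, h] at hi
  exact add_right_cancel hi

/-- Remove the extra cells taken by the labels. -/
def compress (a : ℕ) (x : Fin n → ℤ) (i : Fin n) : ℤ := x i - a * valueRank x i

theorem ShiAvoids.injective {a : ℕ} (ha : 1 ≤ a) {x : Fin n → ℤ} (hx : ShiAvoids a x) :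
    Function.Injective x := by
  intro i j h
  by_contra hne
  obtain hij | hij := lt_or_gt_of_ne hne
  · exact hx i j hij 0 (by omega) (by omega) (by simp [h])
  · exact hx j i hij 0 (by omega) (by omega) (by simp [h])

theorem ShiAvoids.labelBefore_compress {a : ℕ} (ha : 1 ≤ a) {x : Fin n → ℤ} (hx : ShiAvoids a x)
    {i j : Fin n} (h : x j < x i) : LabelBefore (compress a x) j i := by
  induction hd : (x i - x j).toNat using Nat.strong_induction_on generalizing i j with
  | _ d ih =>
    by_cases hl : ∃ l, x j < x l ∧ x l < x i
    · obtain ⟨l, h1, h2⟩ := hl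
      exact (ih _ (by omega) h1 rfl).trans (ih _ (by omega) h2 rfl)
    · push Not at hl
      have hr : valueRank x i = valueRank x j + 1 := by
        unfold valueRank
        rw [← Finset.card_insert_of_notMem (a := j) (by simp)]
        congr 1
        ext l
        simp only [Finset.mem_filter, Finset.mem_univ, true_and, Finset.mem_insert]
        refine ⟨fun hli => ?_, ?_⟩
        · by_cases hlj : l = j
          · exact Or.inl hlj
          · refine Or.inr (lt_of_le_of_ne ?_ fun he => hlj (hx.injective ha he))
            by_contra hlt
            exact absurd (hl l (not_le.1 hlt)) (not_le.2 hli)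
        · rintro (rfl | hlj)
          · exact h
          · exact hlj.trans h
      have hc : compress a x i - compress a x j = x i - x j - a := by
        unfold compress
        rw [hr]
        push_cast
        ring
      have hne : i ≠ j := by rintro rfl; exact lt_irrefl _ h
      unfold LabelBefore
      obtain hij | hij := lt_or_gt_of_ne hne
      · have := hx i j hij (x i - x j)
        simp only [Int.cast_id, ne_eq, not_true, imp_false] at this
        omega
      · have := hx j i hij (x j - x i)
        simp only [Int.cast_id, ne_eq, not_true, imp_false] at this
        omega

theorem ShiAvoids.spread_compress {a : ℕ} (ha : 1 ≤ a) {x : Fin n → ℤ} (hx : ShiAvoids a x) :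
    spread a (compress a x) = x := by
  classical
  ext i
  have : labelRank (compress a x) i = valueRank x i := by
    unfold labelRank valueRank
    congr 1
    ext j
    simp only [Finset.mem_filter, Finset.mem_univ, true_and]
    refine ⟨fun h => ?_, hx.labelBefore_compress ha⟩
    by_contra hlt
    obtain hlt | heq := (not_lt.1 hlt).lt_or_eq
    · exact h.not_symm (hx.labelBefore_compress ha hlt)
    · obtain rfl := hx.injective ha heq
      exact h.not_symm h
  unfold spread
  rw [this, compress]
  ring

theorem ShiAvoids.compress_mem {a m : ℕ} (ha : 1 ≤ a) {x : Fin n → ℤ} (hx : ShiAvoids a x)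
    (hb : ∀ i, 0 ≤ x i ∧ x i + a < a * n + m) (i : Fin n) :
    0 ≤ compress a x i ∧ compress a x i < m := by
  have hmono : ∀ i j, x j ≤ x i → compress a x j ≤ compress a x i := by
    intro i j h
    obtain h | h := h.lt_or_eq
    · exact (hx.labelBefore_compress ha h).le
    · rw [hx.injective ha h]
  constructor
  · obtain ⟨l, -, hl⟩ := Finset.exists_min_image Finset.univ x ⟨i, Finset.mem_univ i⟩
    have hr : valueRank x l = 0 := by
      simp only [valueRank, Finset.card_eq_zero, Finset.filter_eq_empty_iff, not_lt]
      exact hl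
    have := hmono i l (hl i (Finset.mem_univ i))
    have := (hb l).1
    simp only [compress, hr] at *
    push_cast at *
    linarith
  · obtain ⟨l, -, hl⟩ := Finset.exists_max_image Finset.univ x ⟨i, Finset.mem_univ i⟩
    have hr : valueRank x l + 1 = n := by
      have : (Finset.univ.filter fun j => x j < x l) = Finset.univ.erase l := by
        ext j
        simp only [Finset.mem_filter, Finset.mem_univ, true_and, Finset.mem_erase, and_true]
        refine ⟨by rintro h rfl; exact lt_irrefl _ h, fun h => ?_⟩
        exact lt_of_le_of_ne (hl j (Finset.mem_univ j)) fun he => h (hx.injective ha he)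
      rw [valueRank, this, Finset.card_erase_add_one (Finset.mem_univ l), Finset.card_univ,
        Fintype.card_fin]
    have h1 := hmono l i (hl i (Finset.mem_univ i))
    have h2 := (hb l).2
    have hn : (n : ℤ) = valueRank x l + 1 := by exact_mod_cast hr.symm
    refine h1.trans_lt ?_
    rw [hn] at h2
    unfold compress
    linarith

theorem spread_mem {a m : ℕ} {f : Fin n → ℤ} (hf : ∀ i, 0 ≤ f i ∧ f i < m)
    (i : Fin n) : 0 ≤ spread a f i ∧ spread a f i + a < a * n + m := by
  have h1 : ((labelRank f i : ℤ) + 1) ≤ n := by exact_mod_cast labelRank_lt_card f i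
  have h2 := mul_le_mul_of_nonneg_left h1 (Int.natCast_nonneg a)
  have h3 : (0 : ℤ) ≤ a * labelRank f i := by positivity
  have := hf i
  unfold spread
  constructor <;> linarith

theorem card_shiAvoids_int {a : ℕ} (ha : 1 ≤ a) (n m : ℕ) :
    Nat.card {x : Fin n → ℤ // ShiAvoids a x ∧ ∀ i, 0 ≤ x i ∧ x i + a < a * n + m} = m ^ n := by
  have e : (Fin n → Set.Ico (0 : ℤ) m) ≃
      {x : Fin n → ℤ // ShiAvoids a x ∧ ∀ i, 0 ≤ x i ∧ x i + a < a * n + m} := by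
    refine Equiv.ofBijective (fun f => ⟨spread a fun i => f i, shiAvoids_spread _,
      spread_mem fun i => (f i).2⟩) ⟨fun f g h => ?_, fun ⟨x, hx, hb⟩ => ?_⟩
    · have := spread_injective ha (Subtype.ext_iff.1 h)
      ext i
      exact congrFun this i
    · exact ⟨fun i => ⟨compress a x i, hx.compress_mem ha hb i⟩,
        Subtype.ext (hx.spread_compress ha)⟩
  rw [← Nat.card_congr e, Nat.card_eq_fintype_card]
  simp

theorem intCast_eq_intCast_iff_of_abs_lt {q : ℕ} {u v : ℤ} (h : |u - v| < q) :
    (u : ZMod q) = v ↔ u = v := by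
  refine ⟨fun he => ?_, fun he => he ▸ rfl⟩
  rw [eq_comm, ZMod.intCast_eq_intCast_iff_dvd_sub] at he
  exact sub_eq_zero.1 (Int.eq_zero_of_abs_lt_dvd he h)

theorem shiAvoids_cast_iff {a q : ℕ} {x : Fin n → ℤ}
    (hb : ∀ i, 0 ≤ x i ∧ x i + a < q) :
    ShiAvoids a (fun i => (x i : ZMod q)) ↔ ShiAvoids a x := by
  unfold ShiAvoids
  refine forall₃_congr fun i j _ => forall₃_congr fun k hk hk' => not_congr ?_
  rw [← Int.cast_sub, Int.cast_id, intCast_eq_intCast_iff_of_abs_lt]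
  have := hb i
  have := hb j
  rw [abs_lt]
  omega

/-- The cell `p` is not among the `a` cells following each of the points `x i`. -/
def Uncovered {q : ℕ} (a : ℕ) (x : Fin n → ZMod q) (p : ZMod q) : Prop :=
  ∀ i, ∀ t < a, x i + (t : ℕ) ≠ p

theorem card_shiAvoids_uncovered {a : ℕ} (ha : 1 ≤ a) (n m : ℕ) (hm : 1 ≤ m) :
    Nat.card {x : Fin n → ZMod (a * n + m) // ShiAvoids a x ∧ Uncovered a x (-1)} = m ^ n := by
  rw [← card_shiAvoids_int ha n m]
  set q := a * n + m with hq
  have : NeZero q := ⟨by omega⟩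
  have hqz : (a * n + m : ℤ) = q := by rw [hq]; push_cast; rfl
  rw [hqz]
  symm
  refine Nat.card_congr (Equiv.ofBijective
    (fun x => ⟨fun i => (x.1 i : ZMod q), (shiAvoids_cast_iff x.2.2).2 x.2.1, ?_⟩)
    ⟨fun x y h => ?_, fun ⟨x, hx, hu⟩ => ?_⟩)
  · intro i t ht h
    have hb := x.2.2 i
    have : ((x.1 i + t + 1 : ℤ) : ZMod q) = (0 : ℤ) := by
      push_cast
      rw [h]
      ring
    rw [intCast_eq_intCast_iff_of_abs_lt (by rw [abs_lt]; omega)] at this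
    omega
  · ext i
    have := congrFun (Subtype.ext_iff.1 h) i
    have h1 := x.2.2 i
    have h2 := y.2.2 i
    exact (intCast_eq_intCast_iff_of_abs_lt (by rw [abs_lt]; omega)).1 this
  · have hb : ∀ i, 0 ≤ ((x i).val : ℤ) ∧ ((x i).val : ℤ) + a < q := by
      intro i
      refine ⟨by positivity, ?_⟩
      by_contra hlt
      have hv := (x i).val_lt
      refine hu i (q - 1 - (x i).val) (by omega) ?_
      have : (((x i).val + (q - 1 - (x i).val) + 1 : ℕ) : ZMod q) = 0 := by
        rw [show (x i).val + (q - 1 - (x i).val) + 1 = q by omega, ZMod.natCast_self]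
      rw [Nat.cast_add, Nat.cast_add, ZMod.natCast_zmod_val, Nat.cast_one] at this
      exact eq_neg_of_add_eq_zero_left this
    have hcast : (fun i => (((x i).val : ℤ) : ZMod q)) = x := by ext i; simp
    refine ⟨⟨fun i => (x i).val, (shiAvoids_cast_iff hb).1 (by rwa [hcast]), hb⟩, ?_⟩
    exact Subtype.ext hcast

theorem ShiAvoids.card_uncovered {a m : ℕ} (hm : 1 ≤ m)
    {x : Fin n → ZMod (a * n + m)} (hx : ShiAvoids a x) :
    Nat.card {p // Uncovered a x p} = m := by
  classical
  have : NeZero (a * n + m) := ⟨by omega⟩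
  let g : Fin n × Fin a → ZMod (a * n + m) := fun w => x w.1 + (w.2 : ℕ)
  have hne : ∀ i j, i < j → ∀ s t : Fin a, x i + (s : ℕ) ≠ x j + (t : ℕ) := by
    intro i j hij s t h
    refine hx i j hij (t - s) (by omega) (by omega) ?_
    push_cast
    linear_combination h
  have hg : Function.Injective g := by
    rintro ⟨i, s⟩ ⟨j, t⟩ h
    simp only [g] at h
    obtain hij | rfl | hij := lt_trichotomy i j
    · exact absurd h (hne i j hij s t)
    · have hn : 1 ≤ n := i.pos
      have han : a * 1 ≤ a * n := Nat.mul_le_mul_left a hn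
      have h' : ((s : ℤ) : ZMod (a * n + m)) = (t : ℤ) := by
        push_cast
        exact add_left_cancel h
      rw [intCast_eq_intCast_iff_of_abs_lt (by rw [abs_lt]; push_cast; omega)] at h'
      rw [Prod.mk.injEq]
      exact ⟨rfl, Fin.ext (by exact_mod_cast h')⟩
    · exact absurd h.symm (hne j i hij t s)
  have hset : {p | Uncovered a x p} = (Set.range g)ᶜ := by
    ext p
    simp only [Uncovered, Set.mem_ofPred_eq, Set.mem_compl_iff, Set.mem_range, Prod.exists,
      not_exists, g]
    exact ⟨fun h i t => h i t t.2, fun h i t ht => h i ⟨t, ht⟩⟩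
  have h1 : Nat.card {p // Uncovered a x p} = ((Set.range g)ᶜ).ncard := by
    rw [← hset]; rfl
  have h2 : (Set.range g).ncard = n * a := by
    rw [← Set.image_univ, Set.ncard_image_of_injective _ hg, Set.ncard_univ]
    simp
  have h3 := Set.ncard_add_ncard_compl (Set.range g)
  rw [h2, Nat.card_eq_fintype_card, ZMod.card] at h3
  rw [h1]
  rw [mul_comm n a] at h3
  omega

theorem card_shiAvoids_uncovered_eq {q : ℕ} (a : ℕ) (p : ZMod q) :
    Nat.card {x : Fin n → ZMod q // ShiAvoids a x ∧ Uncovered a x p} =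
      Nat.card {x : Fin n → ZMod q // ShiAvoids a x ∧ Uncovered a x (-1)} := by
  refine Nat.card_congr ((Equiv.subRight fun _ => p + 1).subtypeEquiv fun x => ?_)
  simp only [ShiAvoids, Uncovered, Equiv.subRight_apply, Pi.sub_apply, sub_sub_sub_cancel_right]
  refine and_congr Iff.rfl (forall₃_congr fun i t _ => not_congr ?_)
  constructor <;> intro h <;> linear_combination h

theorem card_shiAvoids {a : ℕ} (ha : 1 ≤ a) (n m : ℕ) (hm : 1 ≤ m) :
    Nat.card {x : Fin n → ZMod (a * n + m) // ShiAvoids a x} * m = (a * n + m) * m ^ n := by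
  classical
  have : NeZero (a * n + m) := ⟨by omega⟩
  have e1 : (Σ x : {x : Fin n → ZMod (a * n + m) // ShiAvoids a x}, {p // Uncovered a x.1 p}) ≃
      Σ p : ZMod (a * n + m), {x : Fin n → ZMod (a * n + m) // ShiAvoids a x ∧ Uncovered a x p} :=
    { toFun := fun w => ⟨w.2.1, w.1.1, w.1.2, w.2.2⟩
      invFun := fun w => ⟨⟨w.2.1, w.2.2.1⟩, w.1, w.2.2.2⟩
      left_inv := fun _ => rfl
      right_inv := fun _ => rfl }
  have := Nat.card_congr e1
  rw [Nat.card_sigma, Nat.card_sigma, Finset.sum_congr rfl fun x _ => x.2.card_uncovered hm,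
    Finset.sum_congr rfl fun p _ => (card_shiAvoids_uncovered_eq a p).trans
      (card_shiAvoids_uncovered ha n m hm)] at this
  simpa only [Finset.sum_const, Finset.card_univ, smul_eq_mul,
    ← Nat.card_eq_fintype_card, Nat.card_zmod] using this

end Counting

/-- The triples `(i, j, k)` of the extended Shi arrangement. -/
noncomputable def shiList (a n : ℕ) : List (Fin n × Fin n × ℤ) :=
  ((Finset.univ ×ˢ Finset.univ ×ˢ Finset.Icc (-(a : ℤ) + 1) a).filter
    fun e => e.1 < e.2.1).toList

theorem forall_mem_shiList_iff {K : Type*} [Ring K] {a n : ℕ} {x : Fin n → K} :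
    (∀ e ∈ shiList a n, gainForm e x ≠ 0) ↔ ShiAvoids a x := by
  simp only [shiList, Finset.mem_toList, Finset.mem_filter, Finset.mem_product, Finset.mem_univ,
    true_and, Finset.mem_Icc, Prod.forall, gainForm, sub_ne_zero, ShiAvoids]
  exact ⟨fun h i j hij k hk hk' => h i j k ⟨⟨hk, hk'⟩, hij⟩,
    fun h i j k hk => h i j hk.2 k hk.1.1 hk.1.2⟩

theorem pointCount_shiList {a n : ℕ} (ha : 1 ≤ a) (hn : 1 ≤ n) {m : ℕ} (hm : 1 ≤ m) :
    pointCount (a * n + m) (shiList a n) = (a * n + m) * m ^ (n - 1) := by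
  have h := card_shiAvoids ha n m hm
  obtain ⟨l, rfl⟩ := Nat.exists_eq_add_of_le' hn
  rw [pow_succ, ← mul_assoc] at h
  rw [pointCount, Nat.add_sub_cancel, ← Nat.eq_of_mul_eq_mul_right hm h]
  exact Nat.card_congr (Equiv.subtypeEquivRight fun x => forall_mem_shiList_iff)

theorem cellCount_shiList {a n : ℕ} (ha : 1 ≤ a) (hn : 1 ≤ n) :
    cellCount (shiList a n) Set.univ = (a * n + 1) ^ (n - 1) := by
  obtain ⟨P, ⟨q₀, hP⟩, hr⟩ := exists_charPoly (shiList a n)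
  have hPX : P = X * (X - C ((a * n : ℕ) : ℤ)) ^ (n - 1) := by
    refine eq_of_infinite_eval_eq _ _ (Set.infinite_of_injective_forall_mem
      (f := fun m : ℕ => ((a * n + (m + q₀ + 1) : ℕ) : ℤ)) (fun s t h => ?_) fun m => ?_)
    · simp only [Nat.cast_inj] at h
      omega
    · rw [Set.mem_ofPred_eq, ← hP _ (by omega), pointCount_shiList ha hn (by omega)]
      simp only [eval_mul, eval_pow, eval_sub, eval_X, eval_C]
      push_cast
      ring
  obtain ⟨l, rfl⟩ := Nat.exists_eq_add_of_le' hn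
  rw [hPX, Fintype.card_fin] at hr
  simp only [eval_mul, eval_pow, eval_sub, eval_X, eval_C, Nat.add_sub_cancel] at hr ⊢
  have : (-1 - ((a * (l + 1) : ℕ) : ℤ)) = (-1) * ((a * (l + 1) + 1 : ℕ) : ℤ) := by
    push_cast; ring
  rw [this, mul_pow, pow_succ, mul_assoc, ← mul_assoc (-1 : ℤ) (-1), neg_one_mul, neg_neg, one_mul,
    ← mul_assoc, ← mul_pow, neg_one_mul, neg_neg, one_pow, one_mul] at hr
  exact_mod_cast hr

/-- The number of regions of the extended Shi arrangement (hyperplanes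
`x_i - x_j = -a+1, ..., a` for `i < j` in `V_{n-1}`) equals `(an+1)^(n-1)`. -/
theorem stmt17 (a n : ℕ) (ha : 1 ≤ a) (hn : 1 ≤ n) :
    numRegions {x : Fin n → ℝ | (∑ i, x i) = 0 ∧
        ∀ i j : Fin n, i < j → ∀ k : ℤ,
          -(a : ℤ) + 1 ≤ k → k ≤ (a : ℤ) → x i - x j ≠ (k : ℝ)} =
      (a * n + 1) ^ (n - 1) := by
  have : Nonempty (Fin n) := ⟨⟨0, hn⟩⟩
  have hC : Convex ℝ {x : Fin n → ℝ | ∑ i, x i = 0} := by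
    intro x hx y hy s t _ _ _
    simp only [Set.mem_ofPred_eq] at hx hy
    simp [Finset.sum_add_distrib, ← Finset.mul_sum, hx, hy]
  have h := cellCount_inter_sum_eq_zero (shiList a n) (C := Set.univ) fun _ _ _ => Set.mem_univ _
  rw [Set.univ_inter, cellCount_shiList ha hn, ← (numRegions_eq_cellCount (shiList a n) hC).2] at h
  rw [← h]
  congr 1
  ext x
  simp only [Set.mem_ofPred_eq, Set.mem_inter_iff, forall_mem_shiList_iff]
  rfl
end

section
/- Let a, b be integers with 0 ≤ a < b and a + b ≥ 2, and let n ≥ 2. Consider the complex polynomial Q_n(q) = Σ_φ (q − φ(1) − φ(2) − ⋯ − φ(n))^{n−1}, where the sum is over all functions φ : {1,...,n} → {a, a+1, ..., b−1} (this polynomial equals (b−a)^n times the characteristic polynomial of the truncated affine arrangement A^{ab}_{n-1}). Then every complex root of Q_n has real part equal to (a + b − 1)·n/2. -/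
open Polynomial

/-- Moving closer to every element of a nonempty multiset strictly decreases the product of the
distances to its elements. -/
theorem Multiset.prod_norm_sub_lt {E : Type*} [SeminormedAddCommGroup E] {z w : E} {s : Multiset E}
    (hs : s ≠ 0) (h : ∀ x ∈ s, ‖z - x‖ < ‖w - x‖) :
    (s.map fun x => ‖z - x‖).prod < (s.map fun x => ‖w - x‖).prod := by
  induction s using Multiset.induction_on with
  | empty => exact absurd rfl hs
  | cons x s ih =>
    rw [Multiset.map_cons, Multiset.prod_cons, Multiset.map_cons, Multiset.prod_cons]
    have hx := h x (Multiset.mem_cons_self x s)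
    rcases eq_or_ne s 0 with rfl | hs'
    · simpa using hx
    · have hlt := ih hs' fun y hy => h y (Multiset.mem_cons_of_mem hy)
      exact mul_lt_mul'' hx hlt (norm_nonneg _)
        (Multiset.prod_nonneg fun y hy => by
          obtain ⟨u, -, rfl⟩ := Multiset.mem_map.1 hy
          exact norm_nonneg _)

/-- If `z` is closer than `w` to every root of a nonconstant complex polynomial, then the polynomial
is smaller in norm at `z` than at `w`. -/
theorem Polynomial.norm_eval_lt_norm_eval {f : ℂ[X]} (hf : 0 < f.natDegree) {z w : ℂ}
    (h : ∀ x, f.IsRoot x → ‖z - x‖ < ‖w - x‖) : ‖f.eval z‖ < ‖f.eval w‖ := by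
  have hf0 : f ≠ 0 := ne_zero_of_natDegree_gt hf
  have hsplit := IsAlgClosed.splits f
  have hnorm (u : ℂ) :
      ‖f.eval u‖ = ‖f.leadingCoeff‖ * (f.roots.map fun x => ‖u - x‖).prod := by
    rw [hsplit.eval_eq_prod_roots, norm_mul]
    congr 1
    exact (map_multiset_prod (normHom : ℂ →*₀ ℝ) _).trans (by rw [Multiset.map_map]; rfl)
  rw [hnorm, hnorm]
  refine mul_lt_mul_of_pos_left (Multiset.prod_norm_sub_lt ?_
    fun x hx => h x (isRoot_of_mem_roots hx))
    (norm_pos_iff.2 (leadingCoeff_ne_zero.2 hf0))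
  rw [← Multiset.card_pos, ← hsplit.natDegree_eq_card_roots]
  exact hf

theorem Complex.norm_sub_lt_norm_sub_iff_of_im_eq {z w x : ℂ} (h : z.im = w.im) :
    ‖z - x‖ < ‖w - x‖ ↔ |z.re - x.re| < |w.re - x.re| := by
  rw [← sq_lt_sq₀ (norm_nonneg _) (norm_nonneg _), ← sq_lt_sq, Complex.sq_norm, Complex.sq_norm,
    Complex.normSq_apply, Complex.normSq_apply]
  simp only [Complex.sub_re, Complex.sub_im, h]
  constructor <;> intro h <;> nlinarith

/-- If all roots of `f` lie on the line `re = r` and `‖ζ‖ = 1`, then all roots of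
`f(X - 1) - ζ f(X)` lie on the line `re = r + 1 / 2`. -/
theorem Polynomial.re_eq_of_isRoot_taylor_sub {f : ℂ[X]} (hf : 0 < f.natDegree) {r : ℝ}
    (hr : ∀ z, f.IsRoot z → z.re = r) {ζ : ℂ} (hζ : ‖ζ‖ = 1) {z : ℂ}
    (hz : (taylor (-1) f - C ζ * f).IsRoot z) : z.re = r + 1 / 2 := by
  have heq : ‖f.eval (z - 1)‖ = ‖f.eval z‖ := by
    have h : f.eval (z - 1) = ζ * f.eval z := by
      rwa [IsRoot.def, eval_sub, eval_mul, eval_C, taylor_eval, ← sub_eq_add_neg, sub_eq_zero] at hz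
    rw [h, norm_mul, hζ, one_mul]
  rcases lt_trichotomy z.re (r + 1 / 2) with hlt | heq' | hgt
  · refine absurd heq (norm_eval_lt_norm_eval hf fun x hx => ?_).ne'
    rw [Complex.norm_sub_lt_norm_sub_iff_of_im_eq (by simp), ← sq_lt_sq, hr x hx]
    simp only [Complex.sub_re, Complex.one_re]
    nlinarith
  · exact heq'
  · refine absurd heq (norm_eval_lt_norm_eval hf fun x hx => ?_).ne
    rw [Complex.norm_sub_lt_norm_sub_iff_of_im_eq (by simp), ← sq_lt_sq, hr x hx]
    simp only [Complex.sub_re, Complex.one_re]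
    nlinarith

theorem Polynomial.natDegree_taylor_sub_pos {f : ℂ[X]} (hf : 0 < f.natDegree) (c : ℂ) {ζ : ℂ}
    (hζ : ζ ≠ 1) : 0 < (taylor c f - C ζ * f).natDegree := by
  refine hf.trans_le (le_natDegree_of_ne_zero ?_)
  rw [coeff_sub, coeff_C_mul, coeff_taylor_natDegree, coeff_natDegree, ← one_sub_mul]
  exact mul_ne_zero (sub_ne_zero.2 hζ.symm) (leadingCoeff_ne_zero.2 (ne_zero_of_natDegree_gt hf))

/-- Applying `∏ (S - ζ)` to `f`, where `S` is the shift `f(X) ↦ f(X - 1)` and the `ζ ≠ 1` lie on the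
unit circle, moves the line containing the roots by half the number of factors. -/
theorem Polynomial.aeval_taylor_prod_X_sub_C_roots {s : Multiset ℂ}
    (hs : ∀ ζ ∈ s, ‖ζ‖ = 1 ∧ ζ ≠ 1) {f : ℂ[X]} (hf : 0 < f.natDegree) {r : ℝ}
    (hr : ∀ z, f.IsRoot z → z.re = r) :
    0 < (aeval (taylor (-1 : ℂ)) (s.map fun ζ => X - C ζ).prod f).natDegree ∧
      ∀ z, (aeval (taylor (-1 : ℂ)) (s.map fun ζ => X - C ζ).prod f).IsRoot z →
        z.re = r + Multiset.card s / 2 := by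
  induction s using Multiset.induction_on with
  | empty => simpa using ⟨hf, hr⟩
  | cons ζ s ih =>
    obtain ⟨hpos, hroot⟩ := ih fun y hy => hs y (Multiset.mem_cons_of_mem hy)
    obtain ⟨hζ, hζ1⟩ := hs ζ (Multiset.mem_cons_self ζ s)
    have h : aeval (taylor (-1 : ℂ)) ((ζ ::ₘ s).map fun ζ => X - C ζ).prod f =
        taylor (-1) (aeval (taylor (-1 : ℂ)) (s.map fun ζ => X - C ζ).prod f) -
          C ζ * aeval (taylor (-1 : ℂ)) (s.map fun ζ => X - C ζ).prod f := by
      rw [Multiset.map_cons, Multiset.prod_cons, map_mul, Module.End.mul_apply, map_sub, aeval_X,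
        aeval_C, LinearMap.sub_apply, Module.algebraMap_end_apply, smul_eq_C_mul]
    rw [h]
    refine ⟨natDegree_taylor_sub_pos hpos _ hζ1, fun z hz => ?_⟩
    rw [re_eq_of_isRoot_taylor_sub hpos hroot hζ hz, Multiset.card_cons]
    push_cast
    ring

theorem Polynomial.re_eq_of_isRoot_aeval_taylor {p : ℂ[X]} (hp0 : p ≠ 0)
    (hp : ∀ ζ, p.IsRoot ζ → ‖ζ‖ = 1 ∧ ζ ≠ 1) {f : ℂ[X]} (hf : 0 < f.natDegree) {r : ℝ}
    (hr : ∀ z, f.IsRoot z → z.re = r) {z : ℂ}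
    (hz : (aeval (taylor (-1 : ℂ)) p f).IsRoot z) : z.re = r + p.natDegree / 2 := by
  have hsplit := IsAlgClosed.splits p
  rw [hsplit.natDegree_eq_card_roots]
  refine (aeval_taylor_prod_X_sub_C_roots (fun ζ hζ => hp ζ (isRoot_of_mem_roots hζ)) hf hr).2 z ?_
  rw [hsplit.eq_prod_roots, map_mul, Module.End.mul_apply, aeval_C, Module.algebraMap_end_apply,
    IsRoot.def, eval_smul, smul_eq_mul] at hz
  exact (mul_eq_zero.1 hz).resolve_left (leadingCoeff_ne_zero.2 hp0)

theorem Polynomial.aeval_taylor_X_pow_apply (k : ℕ) (f : ℂ[X]) :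
    aeval (taylor (-1 : ℂ)) (X ^ k : ℂ[X]) f = taylor (-(k : ℂ)) f := by
  induction k with
  | zero => simp
  | succ k ih =>
    rw [pow_succ', map_mul, Module.End.mul_apply, ih, aeval_X, taylor_taylor]
    push_cast
    congr 2
    ring

theorem Polynomial.taylor_X_sub_C_pow {R : Type*} [CommRing R] (r c : R) (n : ℕ) :
    taylor r ((X - C c) ^ n) = (X - C (c - r)) ^ n := by
  rw [taylor_pow, map_sub, taylor_X, taylor_C, C_sub]
  congr 1
  ring

theorem Polynomial.natDegree_geom_sum {R : Type*} [CommRing R] [Nontrivial R] (m : ℕ) :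
    (∑ k ∈ Finset.range m, (X : R[X]) ^ k).natDegree = m - 1 := by
  rcases eq_or_ne m 0 with rfl | hm
  · simp
  have h := congrArg natDegree (geom_sum_mul (X : R[X]) m)
  rw [← C_1, natDegree_X_pow_sub_C, (monic_geom_sum_X hm).natDegree_mul (monic_X_sub_C 1),
    natDegree_X_sub_C] at h
  omega

theorem Int.sum_Icc_eq_sum_range {M : Type*} [AddCommMonoid M] (a b : ℤ) (g : ℕ → M) :
    ∑ k ∈ Finset.Icc a (b - 1), g (k - a).toNat = ∑ k ∈ Finset.range (b - a).toNat, g k := by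
  refine Finset.sum_nbij' (fun k => (k - a).toNat) (fun k => a + k) ?_ ?_ ?_ ?_ ?_ <;>
    intro k hk <;> simp only [Finset.mem_Icc, Finset.mem_range] at * <;> first | rfl | omega

/-- The sum of shifted powers is the image of a single power under a power of a geometric sum in the
shift operator. -/
theorem Polynomial.sum_piFinset_X_sub_C_pow_eq_aeval_taylor (a b : ℤ) (n d : ℕ) :
    ∑ φ ∈ Fintype.piFinset (fun _ : Fin n => Finset.Icc a (b - 1)),
        ((X : ℂ[X]) - C (∑ i, (φ i : ℂ))) ^ d =
      aeval (taylor (-1 : ℂ)) ((∑ k ∈ Finset.range (b - a).toNat, (X : ℂ[X]) ^ k) ^ n)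
        ((X - C ((n : ℂ) * a)) ^ d) := by
  have h : (∑ k ∈ Finset.range (b - a).toNat, (X : ℂ[X]) ^ k) ^ n =
      ∑ φ ∈ Fintype.piFinset (fun _ : Fin n => Finset.Icc a (b - 1)),
        X ^ ∑ i, (φ i - a).toNat := by
    rw [← Int.sum_Icc_eq_sum_range]
    have := Finset.prod_univ_sum (fun _ : Fin n => Finset.Icc a (b - 1))
      (fun _ k => (X : ℂ[X]) ^ (k - a).toNat)
    simpa [Finset.prod_pow_eq_pow_sum] using this
  rw [h, map_sum, LinearMap.sum_apply]
  refine Finset.sum_congr rfl fun φ hφ => ?_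
  rw [aeval_taylor_X_pow_apply, taylor_X_sub_C_pow]
  congr 3
  have hcast (i : Fin n) : (((φ i - a).toNat : ℕ) : ℂ) = φ i - a := by
    have := Finset.mem_Icc.1 (Fintype.mem_piFinset.1 hφ i)
    have h : (((φ i - a).toNat : ℕ) : ℤ) = φ i - a := Int.toNat_of_nonneg (by omega)
    exact_mod_cast congrArg (Int.cast : ℤ → ℂ) h
  simp [hcast]

/-- "Riemann hypothesis" for unbalanced truncated affine arrangements: every complex
root of `Q_n(q) = ∑_φ (q - φ(1) - ⋯ - φ(n))^(n-1)`, the sum being over all functions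
`φ : {1,...,n} → {a, ..., b-1}`, has real part `(a+b-1)n/2`. -/
theorem stmt18 (a b : ℤ) (h0 : 0 ≤ a) (hab : a < b) (h2 : 2 ≤ a + b)
    (n : ℕ) (hn : 2 ≤ n) (w : ℂ)
    (hw : (∑ φ ∈ Fintype.piFinset (fun _ : Fin n => Finset.Icc a (b - 1)),
        ((X : ℂ[X]) - C (∑ i, (φ i : ℂ))) ^ (n - 1)).IsRoot w) :
    w.re = ((a : ℝ) + (b : ℝ) - 1) * (n : ℝ) / 2 := by
  have hm : 0 < (b - a).toNat := by omega
  set p : ℂ[X] := ∑ k ∈ Finset.range (b - a).toNat, X ^ k with hp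
  have hp1 : p.eval 1 ≠ 0 := by
    simpa [hp, eval_finsetSum] using hm.ne'
  have hp0 : p ≠ 0 := by
    rintro h
    simp [h] at hp1
  rw [sum_piFinset_X_sub_C_pow_eq_aeval_taylor, ← hp] at hw
  have hroots : ∀ ζ, (p ^ n).IsRoot ζ → ‖ζ‖ = 1 ∧ ζ ≠ 1 := by
    intro ζ hζ
    have hζ0 : p.eval ζ = 0 := by
      rw [IsRoot.def, eval_pow] at hζ
      exact eq_zero_of_pow_eq_zero hζ
    refine ⟨Complex.norm_eq_one_of_pow_eq_one (n := (b - a).toNat) ?_ hm.ne', ?_⟩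
    · have h := congrArg (eval ζ) (geom_sum_mul (X : ℂ[X]) (b - a).toNat)
      rw [← hp, eval_mul, hζ0, zero_mul] at h
      simpa [sub_eq_zero] using h.symm
    · rintro rfl
      exact hp1 hζ0
  have hf : 0 < ((X - C ((n : ℂ) * a)) ^ (n - 1)).natDegree := by
    rw [natDegree_pow, natDegree_X_sub_C]
    omega
  have hr : ∀ z, ((X - C ((n : ℂ) * a)) ^ (n - 1)).IsRoot z → z.re = (n : ℝ) * a := by
    intro z hz
    rw [IsRoot.def, eval_pow] at hz
    have h : z = n * a := by
      simpa [sub_eq_zero] using eq_zero_of_pow_eq_zero hz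
    simp [h]
  rw [re_eq_of_isRoot_aeval_taylor (pow_ne_zero n hp0) hroots hf hr hw, natDegree_pow, hp,
    natDegree_geom_sum]
  have hcast : (((b - a).toNat - 1 : ℕ) : ℝ) = b - a - 1 := by
    have h : (((b - a).toNat - 1 : ℕ) : ℤ) = b - a - 1 := by omega
    exact_mod_cast congrArg (Int.cast : ℤ → ℝ) h
  rw [Nat.cast_mul, hcast]
  ring
end
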